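/- arXiv:2503.00243 — 5 statements merged into one kernel-verified Lean document; each statement's English description precedes it below -/
import Mathlib

section
/- Let β₀ ≥ 0, β₂ ≥ 0, β₁ ∈ ℝ, λ₁ > 0 and 0 < λ₂ ≤ 2λ₁. Let R₁ ∈ ℝ and R₂ > 0, and set σ = β₀ + β₁ R₁ + β₂ √R₂. If σ > 0, then (1/σ) · ( −β₁ λ₁ R₁ + (β₂ λ₂ / 2) · (σ² − R₂)/√R₂ ) ≥ −λ₁. -/
open Real

theorem log_volatility_drift_lower_bound
    (β₀ β₂ β₁ lam1 lam2 : ℝ)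
    (hβ₀ : 0 ≤ β₀) (hβ₂ : 0 ≤ β₂)
    (hlam1 : 0 < lam1) (hlam2 : 0 < lam2) (hlam : lam2 ≤ 2 * lam1)
    (R₁ R₂ : ℝ) (hR₂ : 0 < R₂)
    (σ : ℝ) (hσdef : σ = β₀ + β₁ * R₁ + β₂ * Real.sqrt R₂) (hσpos : 0 < σ) :
    -lam1 ≤ (1 / σ) * (-(β₁ * lam1 * R₁) + (β₂ * lam2 / 2) * ((σ^2 - R₂) / Real.sqrt R₂)) := by
  have hs : 0 < Real.sqrt R₂ := Real.sqrt_pos.mpr hR₂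
  have hsq : R₂ = Real.sqrt R₂ * Real.sqrt R₂ := (Real.mul_self_sqrt hR₂.le).symm
  have hdiv : (σ^2 - R₂) / Real.sqrt R₂ = σ^2 / Real.sqrt R₂ - Real.sqrt R₂ := by
    rw [sub_div, Real.div_sqrt]
  rw [hdiv, one_div, inv_mul_eq_div, le_div_iff₀ hσpos]
  have h1 : β₁ * R₁ = σ - β₀ - β₂ * Real.sqrt R₂ := by linarith
  have h2 : -(β₁ * lam1 * R₁) = -(lam1 * (σ - β₀ - β₂ * Real.sqrt R₂)) := by
    rw [← h1]; ring
  have h3 : 0 ≤ β₂ * lam2 / 2 * (σ^2 / Real.sqrt R₂) := by positivity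
  have h4 : 0 ≤ lam1 * β₀ := by positivity
  have h5 : 0 ≤ (β₂ * Real.sqrt R₂) * (2 * lam1 - lam2) :=
    mul_nonneg (by positivity) (by linarith)
  rw [h2]
  nlinarith
end

section
/- Let T > 0, λ₁ > 0, λ₂ > 0, R₂₀ > 0, K ≥ 1, σ₀ ∈ ℝ, R₁₀ ∈ ℝ, β₁, β₂ ∈ ℝ, and let φ : ℝ → ℝ be differentiable with |φ(v)| ≤ K and |φ'(v)| ≤ 1 for all v. With D(u, x) = R₂₀ e^{−λ₂ u} + λ₂ e^{−λ₂ u} ∫₀^u e^{(λ₂ − 2λ₁)s} φ(x(s))² ds and Φ̃(u, x) = (φ(x(u))² e^{−2λ₁ u} − D(u, x))/√(D(u, x)), define for t ∈ [0,T] and x ∈ C([0,T], ℝ): b^{(K)}(t, x) = λ₁(σ₀ − β₁ R₁₀) e^{λ₁ t} + (β₂ λ₂ / 2) e^{λ₁ t} ( λ₁ ∫₀^t Φ̃(u, x) du + Φ̃(t, x) ) and ν^{(K)}(t, x) = β₁ λ₁ x(t). Then there exists a constant C > 0 such that for all t ∈ [0,T] and all x, y ∈ C([0,T], ℝ): |b^{(K)}(t,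 x) − b^{(K)}(t, y)| + |ν^{(K)}(t, x) − ν^{(K)}(t, y)| ≤ C · ‖x − y‖, where ‖·‖ is the sup norm on [0,T]. -/
open MeasureTheory intervalIntegral Real Set

/-- `D(u, x) = R₂₀ e^{−λ₂ u} + λ₂ e^{−λ₂ u} ∫₀^u e^{(λ₂ − 2λ₁)s} φ(x(s))² ds`. -/
noncomputable def Dfun (lam1 lam2 R20 : ℝ) (φ : ℝ → ℝ) (u : ℝ) (x : ℝ → ℝ) : ℝ :=
  R20 * Real.exp (-lam2 * u) +
    lam2 * Real.exp (-lam2 * u) * ∫ s in (0:ℝ)..u, Real.exp ((lam2 - 2 * lam1) * s) * (φ (x s))^2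

/-- `Φ̃(u, x) = (φ(x(u))² e^{−2λ₁ u} − D(u,x)) / √(D(u,x))`. -/
noncomputable def PhiTilde (lam1 lam2 R20 : ℝ) (φ : ℝ → ℝ) (u : ℝ) (x : ℝ → ℝ) : ℝ :=
  ((φ (x u))^2 * Real.exp (-2 * lam1 * u) - Dfun lam1 lam2 R20 φ u x) /
    Real.sqrt (Dfun lam1 lam2 R20 φ u x)

/-- Truncated drift coefficient `b^{(K)}` of the transformed Guyon–Lekeufack volatility. -/
noncomputable def bK (lam1 lam2 R20 σ₀ R10 β₁ β₂ : ℝ) (φ : ℝ → ℝ) (t : ℝ) (x : ℝ → ℝ) : ℝ :=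
  lam1 * (σ₀ - β₁ * R10) * Real.exp (lam1 * t) +
    (β₂ * lam2 / 2) * Real.exp (lam1 * t) *
      (lam1 * (∫ u in (0:ℝ)..t, PhiTilde lam1 lam2 R20 φ u x) + PhiTilde lam1 lam2 R20 φ t x)

/-- Truncated diffusion coefficient `ν^{(K)}`. -/
noncomputable def nuK (lam1 β₁ : ℝ) (t : ℝ) (x : ℝ → ℝ) : ℝ := β₁ * lam1 * x t


lemma aux_alg (A A' D D' M m dA dD : ℝ) (hm : 0 < m) (hD : m ≤ D) (hD' : m ≤ D')
    (hA' : |A'| ≤ M) (h1 : |A - A'| ≤ dA) (h2 : |D - D'| ≤ dD) :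
    |(A - D) / √D - (A' - D') / √D'| ≤ dA / √m + (M / m + 1) * (dD / √m) := by
  have hr : 0 < √m := Real.sqrt_pos.2 hm
  have hp : √m ≤ √D := Real.sqrt_le_sqrt hD
  have hq : √m ≤ √D' := Real.sqrt_le_sqrt hD'
  have em : √m ^ 2 = m := Real.sq_sqrt hm.le
  have eD : √D ^ 2 = D := Real.sq_sqrt (hm.le.trans hD)
  have eD' : √D' ^ 2 = D' := Real.sq_sqrt (hm.le.trans hD')
  generalize √m = r at *
  generalize √D = p at *
  generalize √D' = q at *
  subst em eD eD'
  have hp0 : 0 < p := hr.trans_le hp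
  have hq0 : 0 < q := hr.trans_le hq
  have hM : 0 ≤ M := (abs_nonneg _).trans hA'
  have hdA : 0 ≤ dA := (abs_nonneg _).trans h1
  have hpq : |p - q| ≤ dD / r := by
    rw [le_div_iff₀ hr]
    calc |p - q| * r ≤ |p - q| * (p + q) := by gcongr; linarith
      _ = |p ^ 2 - q ^ 2| := by
        rw [show p ^ 2 - q ^ 2 = (p - q) * (p + q) by ring, abs_mul,
          abs_of_pos (show 0 < p + q by positivity)]
      _ ≤ dD := h2
  have key : (A - p ^ 2) / p - (A' - q ^ 2) / q
      = (A - A') / p + -(A' / (p * q) + 1) * (p - q) := by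
    field_simp; ring
  rw [key]
  refine (abs_add_le _ _).trans (add_le_add ?_ ?_)
  · rw [abs_div, abs_of_pos hp0]
    gcongr
  · rw [abs_mul, abs_neg]
    refine mul_le_mul ?_ hpq (abs_nonneg _) (by positivity)
    refine (abs_add_le _ _).trans ?_
    rw [abs_one, abs_div, abs_of_pos (mul_pos hp0 hq0)]
    gcongr
    nlinarith

lemma aux_sq (K : ℝ) (φ : ℝ → ℝ) (hφdiff : Differentiable ℝ φ)
    (hφbdd : ∀ v : ℝ, |φ v| ≤ K) (hφ'bdd : ∀ v : ℝ, |deriv φ v| ≤ 1) (a b : ℝ) :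
    |φ a ^ 2 - φ b ^ 2| ≤ 2 * K * |a - b| := by
  have h : |φ a - φ b| ≤ 1 * |a - b| := by
    have := Convex.norm_image_sub_le_of_norm_deriv_le (f := φ) (s := univ) (C := 1)
      (x := b) (y := a) (fun z _ => hφdiff z) (fun z _ => hφ'bdd z) convex_univ (mem_univ _)
      (mem_univ _)
    simpa [Real.norm_eq_abs] using this
  have e : φ a ^ 2 - φ b ^ 2 = (φ a + φ b) * (φ a - φ b) := by ring
  rw [e, abs_mul]
  refine mul_le_mul ?_ (by linarith) (abs_nonneg _) (by linarith [(abs_nonneg _).trans (hφbdd a)])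
  linarith [abs_add_le (φ a) (φ b), hφbdd a, hφbdd b]

lemma aux_cont (T lam1 lam2 : ℝ) (φ : ℝ → ℝ) (hφ : Continuous φ) (x : ℝ → ℝ)
    (hx : ContinuousOn x (Icc 0 T)) :
    ContinuousOn (fun s => Real.exp ((lam2 - 2 * lam1) * s) * (φ (x s))^2) (Icc 0 T) := by
  have : ContinuousOn (fun s => φ (x s)) (Icc 0 T) := hφ.comp_continuousOn hx
  fun_prop

lemma aux_int (T lam1 lam2 : ℝ) (φ : ℝ → ℝ) (hφ : Continuous φ) (x : ℝ → ℝ)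
    (hx : ContinuousOn x (Icc 0 T)) (u : ℝ) (hu : u ∈ Icc 0 T) :
    IntervalIntegrable (fun s => Real.exp ((lam2 - 2 * lam1) * s) * (φ (x s))^2) volume 0 u := by
  apply ContinuousOn.intervalIntegrable
  rw [uIcc_of_le hu.1]
  exact (aux_cont T lam1 lam2 φ hφ x hx).mono (Icc_subset_Icc_right hu.2)

lemma aux_D_lower (T lam1 lam2 R20 : ℝ) (hlam2 : 0 < lam2) (hR20 : 0 < R20)
    (φ : ℝ → ℝ) (x : ℝ → ℝ) (u : ℝ) (hu : u ∈ Icc 0 T) :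
    R20 * Real.exp (-lam2 * T) ≤ Dfun lam1 lam2 R20 φ u x := by
  unfold Dfun
  have h1 : R20 * Real.exp (-lam2 * T) ≤ R20 * Real.exp (-lam2 * u) := by
    have := hu.2
    gcongr R20 * Real.exp ?_
    nlinarith
  have h2 : 0 ≤ ∫ s in (0:ℝ)..u, Real.exp ((lam2 - 2 * lam1) * s) * (φ (x s))^2 :=
    intervalIntegral.integral_nonneg hu.1 (fun s _ => by positivity)
  have : 0 ≤ lam2 * Real.exp (-lam2 * u) * ∫ s in (0:ℝ)..u, Real.exp ((lam2 - 2 * lam1) * s) * (φ (x s))^2 := by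
    positivity
  linarith

lemma aux_D_cont (T lam1 lam2 R20 : ℝ) (hT : 0 < T) (φ : ℝ → ℝ) (hφ : Continuous φ) (x : ℝ → ℝ)
    (hx : ContinuousOn x (Icc 0 T)) :
    ContinuousOn (fun u => Dfun lam1 lam2 R20 φ u x) (Icc 0 T) := by
  have : ContinuousOn (fun u => ∫ s in (0:ℝ)..u, Real.exp ((lam2 - 2 * lam1) * s) * (φ (x s))^2)
      (Icc 0 T) := by
    have := intervalIntegral.continuousOn_primitive_interval (a := 0) (b := T) (μ := volume)
      (f := fun s => Real.exp ((lam2 - 2 * lam1) * s) * (φ (x s))^2)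
      (by rw [uIcc_of_le hT.le]; exact (aux_cont T lam1 lam2 φ hφ x hx).integrableOn_Icc)
    rwa [uIcc_of_le hT.le] at this
  unfold Dfun
  fun_prop

lemma aux_D_lip (T lam1 lam2 R20 K N : ℝ) (hlam2 : 0 < lam2) (hK : 1 ≤ K)
    (φ : ℝ → ℝ) (hφdiff : Differentiable ℝ φ)
    (hφbdd : ∀ v : ℝ, |φ v| ≤ K) (hφ'bdd : ∀ v : ℝ, |deriv φ v| ≤ 1) (x y : ℝ → ℝ)
    (hx : ContinuousOn x (Icc 0 T)) (hy : ContinuousOn y (Icc 0 T))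
    (hN : ∀ s ∈ Icc 0 T, |x s - y s| ≤ N) (u : ℝ) (hu : u ∈ Icc 0 T) :
    |Dfun lam1 lam2 R20 φ u x - Dfun lam1 lam2 R20 φ u y| ≤
      lam2 * (Real.exp (|lam2 - 2 * lam1| * T) * (2 * K * N) * T) := by
  have hN0 : 0 ≤ N := (abs_nonneg _).trans (hN u hu)
  have e : Dfun lam1 lam2 R20 φ u x - Dfun lam1 lam2 R20 φ u y = lam2 * Real.exp (-lam2 * u) *
      ∫ s in (0:ℝ)..u, (Real.exp ((lam2 - 2 * lam1) * s) * (φ (x s))^2 -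
        Real.exp ((lam2 - 2 * lam1) * s) * (φ (y s))^2) := by
    rw [intervalIntegral.integral_sub (aux_int T lam1 lam2 φ hφdiff.continuous x hx u hu)
      (aux_int T lam1 lam2 φ hφdiff.continuous y hy u hu)]
    unfold Dfun; ring
  have hI := intervalIntegral.norm_integral_le_of_norm_le_const (a := 0) (b := u)
    (C := Real.exp (|lam2 - 2 * lam1| * T) * (2 * K * N))
    (f := fun s => Real.exp ((lam2 - 2 * lam1) * s) * (φ (x s))^2 -
        Real.exp ((lam2 - 2 * lam1) * s) * (φ (y s))^2) (by
      intro s hs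
      rw [uIoc_of_le hu.1] at hs
      have hs' : s ∈ Icc 0 T := ⟨hs.1.le, hs.2.trans hu.2⟩
      rw [← mul_sub, Real.norm_eq_abs, abs_mul, abs_of_pos (Real.exp_pos _)]
      have h1 : (lam2 - 2 * lam1) * s ≤ |lam2 - 2 * lam1| * T :=
        mul_le_mul (le_abs_self _) hs'.2 hs'.1 (abs_nonneg _)
      have h2 : |φ (x s) ^ 2 - φ (y s) ^ 2| ≤ 2 * K * N :=
        (aux_sq K φ hφdiff hφbdd hφ'bdd _ _).trans (by gcongr; exact hN s hs')
      gcongr)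
  rw [Real.norm_eq_abs, sub_zero, abs_of_nonneg hu.1] at hI
  rw [e, abs_mul, abs_of_pos (mul_pos hlam2 (Real.exp_pos _)), mul_assoc]
  have h3 : Real.exp (-lam2 * u) ≤ 1 := Real.exp_le_one_iff.2 (by nlinarith [hu.1])
  refine mul_le_mul_of_nonneg_left ?_ hlam2.le
  refine (mul_le_of_le_one_left (abs_nonneg _) h3).trans (hI.trans ?_)
  have := hu.2
  gcongr

lemma aux_Phi_cont (T lam1 lam2 R20 : ℝ) (hT : 0 < T) (hlam2 : 0 < lam2) (hR20 : 0 < R20)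
    (φ : ℝ → ℝ) (hφ : Continuous φ) (x : ℝ → ℝ)
    (hx : ContinuousOn x (Icc 0 T)) :
    ContinuousOn (fun u => PhiTilde lam1 lam2 R20 φ u x) (Icc 0 T) := by
  have h1 : ContinuousOn (fun s => φ (x s)) (Icc 0 T) := hφ.comp_continuousOn hx
  have h2 := aux_D_cont T lam1 lam2 R20 hT φ hφ x hx
  unfold PhiTilde
  refine ContinuousOn.div (by fun_prop) h2.sqrt ?_
  intro u hu
  have := aux_D_lower T lam1 lam2 R20 hlam2 hR20 φ x u hu
  exact (Real.sqrt_pos.2 (lt_of_lt_of_le (by positivity) this)).ne'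

theorem bK_nuK_lipschitz
    (T lam1 lam2 R20 K σ₀ R10 β₁ β₂ : ℝ)
    (hT : 0 < T) (hlam1 : 0 < lam1) (hlam2 : 0 < lam2) (hR20 : 0 < R20) (hK : 1 ≤ K)
    (φ : ℝ → ℝ) (hφdiff : Differentiable ℝ φ)
    (hφbdd : ∀ v : ℝ, |φ v| ≤ K) (hφ'bdd : ∀ v : ℝ, |deriv φ v| ≤ 1) :
    ∃ C : ℝ, 0 < C ∧ ∀ t ∈ Set.Icc (0:ℝ) T, ∀ x y : ℝ → ℝ,
      ContinuousOn x (Set.Icc 0 T) → ContinuousOn y (Set.Icc 0 T) →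
      |bK lam1 lam2 R20 σ₀ R10 β₁ β₂ φ t x - bK lam1 lam2 R20 σ₀ R10 β₁ β₂ φ t y| +
          |nuK lam1 β₁ t x - nuK lam1 β₁ t y| ≤
        C * ⨆ s : Set.Icc (0:ℝ) T, |x s - y s| := by
  set m := R20 * Real.exp (-lam2 * T) with hm
  have hm0 : 0 < m := by positivity
  set E := Real.exp (|lam2 - 2 * lam1| * T) with hE
  have hE0 : 0 < E := Real.exp_pos _
  have hK0 : 0 < K := by linarith
  set L := 2 * K / √m + (K ^ 2 / m + 1) * (lam2 * (E * (2 * K) * T) / √m) with hL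
  have hL0 : 0 < L := by positivity
  refine ⟨|β₂ * lam2 / 2| * Real.exp (lam1 * T) * (lam1 * (L * T) + L) + |β₁ * lam1| + 1,
    by positivity, ?_⟩
  intro t ht x y hx hy
  set N := ⨆ s : Set.Icc (0:ℝ) T, |x s - y s| with hNdef
  have hN : ∀ s ∈ Icc 0 T, |x s - y s| ≤ N := by
    intro s hs
    have hb : BddAbove (Set.range fun s : Set.Icc (0:ℝ) T => |x s - y s|) := by
      have := (isCompact_Icc (a := (0:ℝ)) (b := T)).bddAbove_image (hx.sub hy).abs
      rwa [image_eq_range] at this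
    exact le_ciSup hb ⟨s, hs⟩
  have hN0 : 0 ≤ N := (abs_nonneg _).trans (hN t ht)
  have hP : ∀ u ∈ Icc 0 T,
      |PhiTilde lam1 lam2 R20 φ u x - PhiTilde lam1 lam2 R20 φ u y| ≤ L * N := by
    intro u hu
    have h1 : Real.exp (-2 * lam1 * u) ≤ 1 := Real.exp_le_one_iff.2 (by nlinarith [hu.1])
    have h := aux_alg ((φ (x u))^2 * Real.exp (-2 * lam1 * u)) ((φ (y u))^2 * Real.exp (-2 * lam1 * u))
      (Dfun lam1 lam2 R20 φ u x) (Dfun lam1 lam2 R20 φ u y) (K ^ 2) m (2 * K * N)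
      (lam2 * (E * (2 * K * N) * T)) hm0
      (aux_D_lower T lam1 lam2 R20 hlam2 hR20 φ x u hu)
      (aux_D_lower T lam1 lam2 R20 hlam2 hR20 φ y u hu)
      (by
        rw [abs_of_nonneg (by positivity)]
        refine (mul_le_of_le_one_right (sq_nonneg _) h1).trans ?_
        exact sq_le_sq' (abs_le.1 (hφbdd _)).1 (abs_le.1 (hφbdd _)).2)
      (by
        rw [← sub_mul, abs_mul, abs_of_pos (Real.exp_pos _)]
        refine (mul_le_of_le_one_right (abs_nonneg _) h1).trans ?_
        refine (aux_sq K φ hφdiff hφbdd hφ'bdd _ _).trans ?_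
        gcongr
        exact hN u hu)
      (aux_D_lip T lam1 lam2 R20 K N hlam2 hK φ hφdiff hφbdd hφ'bdd x y hx hy hN u hu)
    refine h.trans (le_of_eq ?_)
    rw [hL]; ring
  have hint : ∀ z : ℝ → ℝ, ContinuousOn z (Icc 0 T) →
      IntervalIntegrable (fun u => PhiTilde lam1 lam2 R20 φ u z) volume 0 t := by
    intro z hz
    apply ContinuousOn.intervalIntegrable
    rw [uIcc_of_le ht.1]
    exact (aux_Phi_cont T lam1 lam2 R20 hT hlam2 hR20 φ hφdiff.continuous z hz).mono
      (Icc_subset_Icc_right ht.2)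
  have hI : |∫ u in (0:ℝ)..t, (PhiTilde lam1 lam2 R20 φ u x - PhiTilde lam1 lam2 R20 φ u y)|
      ≤ L * N * T := by
    have := intervalIntegral.norm_integral_le_of_norm_le_const (a := 0) (b := t) (C := L * N)
      (f := fun u => PhiTilde lam1 lam2 R20 φ u x - PhiTilde lam1 lam2 R20 φ u y) (by
        intro s hs
        rw [uIoc_of_le ht.1] at hs
        exact hP s ⟨hs.1.le, hs.2.trans ht.2⟩)
    rw [Real.norm_eq_abs, sub_zero, abs_of_nonneg ht.1] at this
    refine this.trans ?_
    have := ht.2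
    gcongr
  have e1 : bK lam1 lam2 R20 σ₀ R10 β₁ β₂ φ t x - bK lam1 lam2 R20 σ₀ R10 β₁ β₂ φ t y =
      (β₂ * lam2 / 2) * Real.exp (lam1 * t) *
      (lam1 * (∫ u in (0:ℝ)..t, (PhiTilde lam1 lam2 R20 φ u x - PhiTilde lam1 lam2 R20 φ u y)) +
        (PhiTilde lam1 lam2 R20 φ t x - PhiTilde lam1 lam2 R20 φ t y)) := by
    rw [intervalIntegral.integral_sub (hint x hx) (hint y hy)]
    unfold bK; ring
  have e2 : nuK lam1 β₁ t x - nuK lam1 β₁ t y = β₁ * lam1 * (x t - y t) := by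
    unfold nuK; ring
  have h1 : |bK lam1 lam2 R20 σ₀ R10 β₁ β₂ φ t x - bK lam1 lam2 R20 σ₀ R10 β₁ β₂ φ t y| ≤
      |β₂ * lam2 / 2| * Real.exp (lam1 * T) * (lam1 * (L * N * T) + L * N) := by
    rw [e1, abs_mul, abs_mul, abs_of_pos (Real.exp_pos _)]
    have h3 := ht.2
    have h4 := (abs_add_le (lam1 * (∫ u in (0:ℝ)..t,
      (PhiTilde lam1 lam2 R20 φ u x - PhiTilde lam1 lam2 R20 φ u y)))
        (PhiTilde lam1 lam2 R20 φ t x - PhiTilde lam1 lam2 R20 φ t y))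
    rw [abs_mul, abs_of_pos hlam1] at h4
    have h5 := h4.trans (add_le_add (mul_le_mul_of_nonneg_left hI hlam1.le) (hP t ht))
    gcongr
  have h2 : |nuK lam1 β₁ t x - nuK lam1 β₁ t y| ≤ |β₁ * lam1| * N := by
    rw [e2, abs_mul]
    gcongr
    exact hN t ht
  refine (add_le_add h1 h2).trans ?_
  nlinarith
end

section
/- Let T > 0, λ ≥ 0, η ≥ 0, ξ ≥ 0, σ ≥ 0, α, β ∈ ℝ, and 0 < ε < A. Let T_{ε,A} : ℝ → [ε, A] be the clamp T_{ε,A}(v) = min(max(v, ε), A). For t ∈ [0,T] and x ∈ C([0,T], ℝ) define G(t, x) = √(T_{ε,A}(x(t))) − λ e^{−λ t} ∫₀^t e^{λ u} √(T_{ε,A}(x(u))) du, b_{ε,A}(t, x) = ξ (α − β T_{ε,A}(x(t))) ( 4λ² G(t, x)² + η ), and a_{ε,A}(t, x) = σ √(ξ T_{ε,A}(x(t))) · √( 4λ² G(t, x)² + η ). Then there exists a constant C > 0 (depending on ε, A, T, λ, η, ξ, σ, α, β) such that for all t ∈ [0,T] and all x, y ∈ C([0,T], ℝ): |b_{ε,A}(t,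 x) − b_{ε,A}(t, y)| + |a_{ε,A}(t, x) − a_{ε,A}(t, y)| ≤ C · ‖x − y‖, where ‖·‖ is the sup norm on [0,T]. -/
open MeasureTheory intervalIntegral Real Set

/-- The clamp `T_{ε,A}(v) = min(max(v, ε), A)`. -/
noncomputable def clampEA (ε A v : ℝ) : ℝ := min (max v ε) A

/-- `G(t, x) = √(T_{ε,A}(x(t))) − λ e^{−λt} ∫₀^t e^{λu} √(T_{ε,A}(x(u))) du`. -/
noncomputable def Gfun (ε A lam : ℝ) (t : ℝ) (x : ℝ → ℝ) : ℝ :=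
  Real.sqrt (clampEA ε A (x t)) -
    lam * Real.exp (-lam * t) * ∫ u in (0:ℝ)..t, Real.exp (lam * u) * Real.sqrt (clampEA ε A (x u))

/-- Truncated drift coefficient of the Platen–Rendek volatility factor. -/
noncomputable def bEA (ε A lam η ξ α β : ℝ) (t : ℝ) (x : ℝ → ℝ) : ℝ :=
  ξ * (α - β * clampEA ε A (x t)) * (4 * lam^2 * (Gfun ε A lam t x)^2 + η)

/-- Truncated diffusion coefficient of the Platen–Rendek volatility factor. -/
noncomputable def aEA (ε A lam η ξ σ : ℝ) (t : ℝ) (x : ℝ → ℝ) : ℝ :=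
  σ * Real.sqrt (ξ * clampEA ε A (x t)) * Real.sqrt (4 * lam^2 * (Gfun ε A lam t x)^2 + η)

lemma clampEA_mem {ε A : ℝ} (hεA : ε < A) (v : ℝ) : ε ≤ clampEA ε A v ∧ clampEA ε A v ≤ A :=
  ⟨le_min (le_max_right _ _) hεA.le, min_le_right _ _⟩

lemma clampEA_lip (ε A v w : ℝ) : |clampEA ε A v - clampEA ε A w| ≤ |v - w| := by
  unfold clampEA
  refine (abs_min_sub_min_le_max _ _ _ _).trans ?_
  rw [sub_self, abs_zero, max_eq_left (abs_nonneg _)]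
  exact abs_max_sub_max_le_abs _ _ _

lemma continuous_clampEA (ε A : ℝ) : Continuous (clampEA ε A) := by
  unfold clampEA; fun_prop

lemma sqrt_clampEA_lip {ε A : ℝ} (hε : 0 < ε) (hεA : ε < A) (v w : ℝ) :
    |√(clampEA ε A v) - √(clampEA ε A w)| ≤ (√ε)⁻¹ * |v - w| := by
  obtain ⟨h1, -⟩ := clampEA_mem hεA v
  obtain ⟨h2, -⟩ := clampEA_mem hεA w
  have hl := clampEA_lip ε A v w
  set a := clampEA ε A v
  set b := clampEA ε A w
  have ha : √a * √a = a := Real.mul_self_sqrt (by linarith)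
  have hb : √b * √b = b := Real.mul_self_sqrt (by linarith)
  have hs : 0 < √ε := Real.sqrt_pos.2 hε
  have hsa : √ε ≤ √a := Real.sqrt_le_sqrt h1
  have hsb : 0 ≤ √b := Real.sqrt_nonneg b
  have e : |a - b| = |√a - √b| * (√a + √b) := by
    rw [← abs_of_nonneg (show 0 ≤ √a + √b by linarith), ← abs_mul]
    congr 1
    linear_combination -ha + hb
  rw [inv_mul_eq_div, le_div_iff₀ hs]
  refine le_trans ?_ hl
  rw [e]
  exact mul_le_mul_of_nonneg_left (by linarith) (abs_nonneg _)

lemma sqrt_sq_add_lip {η : ℝ} (hη : 0 ≤ η) (a b : ℝ) :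
    |√(a ^ 2 + η) - √(b ^ 2 + η)| ≤ |a - b| := by
  have key : ∀ a b : ℝ, √(a ^ 2 + η) ≤ √(b ^ 2 + η) + |a - b| := by
    intro a b
    apply Real.sqrt_le_iff.2
    refine ⟨by positivity, ?_⟩
    have h1 : √(b ^ 2 + η) ^ 2 = b ^ 2 + η := Real.sq_sqrt (by positivity)
    have h2 : |b| ≤ √(b ^ 2 + η) := Real.abs_le_sqrt (by linarith)
    have h3 : b * (a - b) ≤ |b| * |a - b| := by
      rw [← abs_mul]; exact le_abs_self _
    have h4 := mul_le_mul_of_nonneg_right h2 (abs_nonneg (a - b))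
    have h5 : |a - b| ^ 2 = (a - b) ^ 2 := sq_abs _
    nlinarith
  rw [abs_sub_le_iff]
  have h1 := key a b
  have h2 := key b a
  rw [abs_sub_comm b a] at h2
  constructor <;> linarith

lemma prod_lip {p q p' q' P Q P' Q' D : ℝ} (hp : |p| ≤ P) (hq : |q'| ≤ Q)
    (hpp : |p - p'| ≤ P' * D) (hqq : |q - q'| ≤ Q' * D) :
    |p * q - p' * q'| ≤ (P * Q' + Q * P') * D := by
  have e : p * q - p' * q' = p * (q - q') + q' * (p - p') := by ring
  rw [e]
  refine (abs_add_le _ _).trans ?_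
  rw [abs_mul, abs_mul]
  have h1 := mul_le_mul hp hqq (abs_nonneg _) ((abs_nonneg _).trans hp)
  have h2 := mul_le_mul hq hpp (abs_nonneg _) ((abs_nonneg _).trans hq)
  linarith

/-- Bound for the weighted integral term. -/
lemma weighted_bound {T lam t B : ℝ} (hlam : 0 ≤ lam) (ht : t ∈ Set.Icc (0:ℝ) T)
    (f : ℝ → ℝ) (hB : 0 ≤ B) (hf : ∀ u ∈ Set.Icc (0:ℝ) T, |f u| ≤ B) :
    |lam * Real.exp (-lam * t) * ∫ u in (0:ℝ)..t, Real.exp (lam * u) * f u|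
      ≤ lam * T * Real.exp (lam * T) * B := by
  obtain ⟨h0, hT⟩ := ht
  have hI : |∫ u in (0:ℝ)..t, Real.exp (lam * u) * f u| ≤ Real.exp (lam * T) * B * |t - 0| := by
    rw [← Real.norm_eq_abs]
    apply intervalIntegral.norm_integral_le_of_norm_le_const
    intro u hu
    rw [Set.uIoc_of_le h0] at hu
    rw [Real.norm_eq_abs, abs_mul, abs_of_pos (Real.exp_pos _)]
    refine mul_le_mul ?_ (hf u ⟨hu.1.le, hu.2.trans hT⟩) (abs_nonneg _) (Real.exp_pos _).le
    exact Real.exp_le_exp.2 (mul_le_mul_of_nonneg_left (hu.2.trans hT) hlam)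
  rw [sub_zero, abs_of_nonneg h0] at hI
  have hE : Real.exp (-lam * t) ≤ 1 := Real.exp_le_one_iff.2 (by nlinarith)
  rw [abs_mul, abs_of_nonneg (mul_nonneg hlam (Real.exp_pos _).le)]
  have h1 : Real.exp (lam * T) * B * t ≤ Real.exp (lam * T) * B * T :=
    mul_le_mul_of_nonneg_left hT (by positivity)
  calc _ ≤ (lam * 1) * (Real.exp (lam * T) * B * T) :=
        mul_le_mul (mul_le_mul_of_nonneg_left hE hlam) (hI.trans h1) (abs_nonneg _) (by linarith)
    _ = _ := by ring

lemma Gfun_bound {T lam ε A t : ℝ} (hlam : 0 ≤ lam) (hεA : ε < A)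
    (ht : t ∈ Set.Icc (0:ℝ) T) (x : ℝ → ℝ) :
    |Gfun ε A lam t x| ≤ √A * (1 + lam * T * Real.exp (lam * T)) := by
  have hw : ∀ u, |√(clampEA ε A (x u))| ≤ √A := fun u => by
    rw [abs_of_nonneg (Real.sqrt_nonneg _)]
    exact Real.sqrt_le_sqrt (clampEA_mem hεA _).2
  have h := weighted_bound hlam ht (fun u => √(clampEA ε A (x u))) (Real.sqrt_nonneg A)
    (fun u _ => hw u)
  unfold Gfun
  refine (abs_sub _ _).trans ?_
  have := hw t
  linarith

lemma Gfun_lip {T lam ε A t D : ℝ} (hlam : 0 ≤ lam) (hε : 0 < ε) (hεA : ε < A)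
    (ht : t ∈ Set.Icc (0:ℝ) T) (x y : ℝ → ℝ)
    (hx : ContinuousOn x (Set.Icc 0 T)) (hy : ContinuousOn y (Set.Icc 0 T))
    (hD : ∀ s ∈ Set.Icc (0:ℝ) T, |x s - y s| ≤ D) :
    |Gfun ε A lam t x - Gfun ε A lam t y| ≤
      (√ε)⁻¹ * (1 + lam * T * Real.exp (lam * T)) * D := by
  have hD0 : 0 ≤ D := (abs_nonneg _).trans (hD t ht)
  have hw : ∀ u ∈ Set.Icc (0:ℝ) T,
      |√(clampEA ε A (x u)) - √(clampEA ε A (y u))| ≤ (√ε)⁻¹ * D := fun u hu =>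
    (sqrt_clampEA_lip hε hεA _ _).trans (mul_le_mul_of_nonneg_left (hD u hu) (by positivity))
  have hint : ∀ z : ℝ → ℝ, ContinuousOn z (Set.Icc 0 T) →
      IntervalIntegrable (fun u => Real.exp (lam * u) * √(clampEA ε A (z u))) volume 0 t := by
    intro z hz
    apply ContinuousOn.intervalIntegrable
    rw [Set.uIcc_of_le ht.1]
    have hz' := hz.mono (Set.Icc_subset_Icc_right ht.2)
    have := (continuous_clampEA ε A).comp_continuousOn hz'
    exact ContinuousOn.mul (by fun_prop) (Real.continuous_sqrt.comp_continuousOn this)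
  have h := weighted_bound hlam ht (fun u => √(clampEA ε A (x u)) - √(clampEA ε A (y u)))
    (by positivity) hw
  simp only [mul_sub (Real.exp _)] at h
  rw [intervalIntegral.integral_sub (hint x hx) (hint y hy)] at h
  have ht' := hw t ht
  unfold Gfun
  have e : ∀ a b c I J : ℝ, (a - c * I) - (b - c * J) = (a - b) - c * (I - J) := by
    intros; ring
  rw [e]
  refine (abs_sub _ _).trans ?_
  linarith

theorem platen_truncated_coefficients_lipschitz
    (T lam η ξ σ α β ε A : ℝ)
    (hT : 0 < T) (hlam : 0 ≤ lam) (hη : 0 ≤ η) (hξ : 0 ≤ ξ) (hσ : 0 ≤ σ)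
    (hε : 0 < ε) (hεA : ε < A) :
    ∃ C : ℝ, 0 < C ∧ ∀ t ∈ Set.Icc (0:ℝ) T, ∀ x y : ℝ → ℝ,
      ContinuousOn x (Set.Icc 0 T) → ContinuousOn y (Set.Icc 0 T) →
      |bEA ε A lam η ξ α β t x - bEA ε A lam η ξ α β t y| +
          |aEA ε A lam η ξ σ t x - aEA ε A lam η ξ σ t y| ≤
        C * ⨆ s : Set.Icc (0:ℝ) T, |x s - y s| := by
  have hA : 0 < A := hε.trans hεA
  obtain ⟨K, hK⟩ : ∃ K, K = (√ε)⁻¹ := ⟨_, rfl⟩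
  obtain ⟨M, hM⟩ : ∃ M, M = √A * (1 + lam * T * Real.exp (lam * T)) := ⟨_, rfl⟩
  obtain ⟨L, hL⟩ : ∃ L, L = (√ε)⁻¹ * (1 + lam * T * Real.exp (lam * T)) := ⟨_, rfl⟩
  have hK0 : 0 ≤ K := by rw [hK]; positivity
  have hM0 : 0 ≤ M := by rw [hM]; positivity
  have hL0 : 0 ≤ L := by rw [hL]; positivity
  refine ⟨(ξ * (|α| + |β| * A) * (4 * lam ^ 2 * (2 * M * L)) + (4 * lam ^ 2 * M ^ 2 + η) *
      (ξ * |β|)) + (σ * √ξ * √A * (2 * lam * L) + √(4 * lam ^ 2 * M ^ 2 + η) * (σ * √ξ * K)) + 1,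
      by positivity, ?_⟩
  intro t ht x y hx hy
  obtain ⟨D, hDdef⟩ : ∃ D, D = ⨆ s : Set.Icc (0:ℝ) T, |x s - y s| := ⟨_, rfl⟩
  rw [← hDdef]
  have hD : ∀ s ∈ Set.Icc (0:ℝ) T, |x s - y s| ≤ D := by
    intro s hs
    have hbdd : BddAbove (Set.range fun s : Set.Icc (0:ℝ) T => |x s - y s|) := by
      have hc : ContinuousOn (fun s => |x s - y s|) (Set.Icc 0 T) := (hx.sub hy).abs
      have := (isCompact_Icc.image_of_continuousOn hc).bddAbove
      rwa [Set.image_eq_range] at this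
    rw [hDdef]
    exact le_ciSup hbdd ⟨s, hs⟩
  have hD0 : 0 ≤ D := (abs_nonneg _).trans (hD t ht)
  have hGx := Gfun_bound hlam hεA ht x
  have hGy := Gfun_bound hlam hεA ht y
  have hGl := Gfun_lip hlam hε hεA ht x y hx hy hD
  rw [← hM] at hGx hGy
  rw [← hL] at hGl
  obtain ⟨cx1, cx2⟩ := clampEA_mem hεA (x t)
  obtain ⟨cy1, cy2⟩ := clampEA_mem hεA (y t)
  have hcl := (clampEA_lip ε A (x t) (y t)).trans (hD t ht)
  have hsl : |√(clampEA ε A (x t)) - √(clampEA ε A (y t))| ≤ K * D := by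
    rw [hK]
    exact (sqrt_clampEA_lip hε hεA _ _).trans
      (mul_le_mul_of_nonneg_left (hD t ht) (by positivity))
  unfold bEA aEA
  rw [Real.sqrt_mul hξ, Real.sqrt_mul hξ]
  generalize Gfun ε A lam t x = g at *
  generalize Gfun ε A lam t y = g' at *
  generalize clampEA ε A (x t) = c at *
  generalize clampEA ε A (y t) = c' at *
  have hg2 : g' ^ 2 ≤ M ^ 2 := by
    rw [← sq_abs g']; exact pow_le_pow_left₀ (abs_nonneg _) hGy 2
  have hq : 4 * lam ^ 2 * g' ^ 2 + η ≤ 4 * lam ^ 2 * M ^ 2 + η := by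
    have := mul_le_mul_of_nonneg_left hg2 (show 0 ≤ 4 * lam ^ 2 by positivity)
    linarith
  have hb : |ξ * (α - β * c) * (4 * lam ^ 2 * g ^ 2 + η) -
      ξ * (α - β * c') * (4 * lam ^ 2 * g' ^ 2 + η)| ≤ _ :=
    prod_lip (P := ξ * (|α| + |β| * A)) (Q := 4 * lam ^ 2 * M ^ 2 + η) (P' := ξ * |β|)
      (Q' := 4 * lam ^ 2 * (2 * M * L)) (D := D)
      (by
        rw [abs_mul, abs_of_nonneg hξ]
        refine mul_le_mul_of_nonneg_left ((abs_sub _ _).trans ?_) hξ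
        rw [abs_mul, abs_of_nonneg (hε.le.trans cx1)]
        have := mul_le_mul_of_nonneg_left cx2 (abs_nonneg β)
        linarith)
      (by rwa [abs_of_nonneg (by positivity)])
      (by
        have e : ξ * (α - β * c) - ξ * (α - β * c') = -(ξ * β * (c - c')) := by ring
        rw [e, abs_neg, abs_mul, abs_mul, abs_of_nonneg hξ]
        exact mul_le_mul_of_nonneg_left hcl (by positivity))
      (by
        have e : 4 * lam ^ 2 * g ^ 2 + η - (4 * lam ^ 2 * g' ^ 2 + η)
          = 4 * lam ^ 2 * ((g + g') * (g - g')) := by ring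
        rw [e, abs_mul, abs_of_nonneg (show 0 ≤ 4 * lam ^ 2 by positivity), mul_assoc (4 * lam ^ 2)]
        refine mul_le_mul_of_nonneg_left ?_ (by positivity)
        rw [abs_mul, mul_assoc (2 * M)]
        have : |g + g'| ≤ 2 * M := (abs_add_le _ _).trans (by linarith)
        exact mul_le_mul this hGl (abs_nonneg _) (by positivity))
  have ha : |σ * (√ξ * √c) * √(4 * lam ^ 2 * g ^ 2 + η) -
      σ * (√ξ * √c') * √(4 * lam ^ 2 * g' ^ 2 + η)| ≤ _ :=
    prod_lip (P := σ * √ξ * √A) (Q := √(4 * lam ^ 2 * M ^ 2 + η)) (P' := σ * √ξ * K)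
      (Q' := 2 * lam * L) (D := D)
      (by
        rw [abs_of_nonneg (by positivity), ← mul_assoc]
        exact mul_le_mul_of_nonneg_left (Real.sqrt_le_sqrt cx2) (by positivity))
      (by
        rw [abs_of_nonneg (Real.sqrt_nonneg _)]
        exact Real.sqrt_le_sqrt hq)
      (by
        have e : σ * (√ξ * √c) - σ * (√ξ * √c') = σ * √ξ * (√c - √c') := by ring
        rw [e, abs_mul, abs_of_nonneg (show 0 ≤ σ * √ξ by positivity), mul_assoc (σ * √ξ)]
        exact mul_le_mul_of_nonneg_left hsl (by positivity))
      (by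
        have e : ∀ z : ℝ, 4 * lam ^ 2 * z ^ 2 = (2 * lam * z) ^ 2 := by intro z; ring
        rw [e, e]
        refine (sqrt_sq_add_lip hη _ _).trans ?_
        rw [← mul_sub, abs_mul, abs_of_nonneg (show 0 ≤ 2 * lam by positivity),
          mul_assoc (2 * lam)]
        exact mul_le_mul_of_nonneg_left hGl (by positivity))
  linarith
end

section
/- Let T > 0, λ₁ > 0, λ₂ > 0, β₀ ≥ 0, β₁ > 0, β₂ > 0, α ∈ ℝ, R₂₀ ≥ 0, and let C_T ≥ 1 satisfy ∫₀^t e^{λ₂(β₂−1)(t−u)} du ≤ C_T² for all t ∈ [0,T]. For t ∈ [0,T] and x ∈ C([0,T], ℝ) define ν(t, x) = λ₁ · ( β₀ + β₁ (x(t) − α)² + β₂ ( R₂₀ e^{λ₂(β₂−1) t} + λ₂ ∫₀^t e^{λ₂(β₂−1)(t−u)} (β₀ + β₁ (x(u) − α)²) du ) )^{1/2}. Then for all t ∈ [0,T] and all x, y ∈ C([0,T], ℝ): |ν(t, x) − ν(t, y)| ≤ λ₁ C_T √β₁ (1 + √(β₂ λ₂)) · ‖x − y‖, where ‖·‖ is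 the sup norm on [0,T]. -/
open MeasureTheory intervalIntegral Real Set

/-- The diffusion coefficient of the path-dependent SDE for `R₁` in the extended
Blanc–Donier–Bouchaud model. -/
noncomputable def nuBDB (lam1 lam2 β₀ β₁ β₂ α R20 : ℝ) (t : ℝ) (x : ℝ → ℝ) : ℝ :=
  lam1 * Real.sqrt (β₀ + β₁ * (x t - α)^2 +
    β₂ * (R20 * Real.exp (lam2 * (β₂ - 1) * t) +
      lam2 * ∫ u in (0:ℝ)..t, Real.exp (lam2 * (β₂ - 1) * (t - u)) * (β₀ + β₁ * (x u - α)^2)))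

theorem aux_sqrt (P Q D : ℝ) (hD : 0 ≤ D)
    (h : ∀ s : ℝ, 0 < s → P ≤ (1 + s) * Q + (1 + 1 / s) * D ^ 2) :
    Real.sqrt P ≤ Real.sqrt Q + D := by
  refine le_of_forall_pos_le_add ?_
  intro e he
  have hq := Real.sqrt_nonneg Q
  obtain ⟨a, ha⟩ : ∃ a, a = Real.sqrt Q + e / 2 := ⟨_, rfl⟩
  obtain ⟨b, hb⟩ : ∃ b, b = D + e / 2 := ⟨_, rfl⟩
  have ha0 : 0 < a := by linarith
  have hb0 : 0 < b := by linarith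
  have hQ : Q ≤ a ^ 2 := by
    have h1 : Q ≤ Real.sqrt Q ^ 2 := by
      rcases le_total 0 Q with h0 | h0
      · rw [Real.sq_sqrt h0]
      · exact h0.trans (sq_nonneg _)
    have h2 : Real.sqrt Q ^ 2 ≤ a ^ 2 := pow_le_pow_left₀ hq (by linarith) 2
    linarith
  have hDb : D ^ 2 ≤ b ^ 2 := pow_le_pow_left₀ hD (by linarith) 2
  have h1 := h (b / a) (by positivity)
  have h2 : (1 + b / a) * Q ≤ (1 + b / a) * a ^ 2 :=
    mul_le_mul_of_nonneg_left hQ (by positivity)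
  have h3 : (1 + 1 / (b / a)) * D ^ 2 ≤ (1 + 1 / (b / a)) * b ^ 2 :=
    mul_le_mul_of_nonneg_left hDb (by positivity)
  have h4 : (1 + b / a) * a ^ 2 + (1 + 1 / (b / a)) * b ^ 2 = (a + b) ^ 2 := by
    field_simp
    ring
  have : Real.sqrt P ≤ a + b := Real.sqrt_le_iff.2 ⟨by linarith, by linarith⟩
  linarith

theorem aux_sq_s18 (f g M s : ℝ) (hs : 0 < s) (h : |f - g| ≤ M) :
    f ^ 2 ≤ (1 + s) * g ^ 2 + (1 + 1 / s) * M ^ 2 := by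
  have h1 : (f - g) ^ 2 ≤ M ^ 2 := by
    rw [← sq_abs (f - g)]
    exact pow_le_pow_left₀ (abs_nonneg _) h 2
  have h2 : (1 + 1 / s) * (f - g) ^ 2 ≤ (1 + 1 / s) * M ^ 2 :=
    mul_le_mul_of_nonneg_left h1 (by positivity)
  have h3 : (1 + s) * g ^ 2 + (1 + 1 / s) * (f - g) ^ 2 - f ^ 2
      = (s * g - (f - g)) ^ 2 / s := by
    field_simp
    ring
  have h4 : 0 ≤ (s * g - (f - g)) ^ 2 / s := by positivity
  linarith

theorem aux_one
    (T lam1 lam2 β₀ β₁ β₂ α R20 CT M : ℝ)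
    (hlam1 : 0 < lam1) (hlam2 : 0 < lam2)
    (hβ₀ : 0 ≤ β₀) (hβ₁ : 0 < β₁) (hβ₂ : 0 < β₂) (hR20 : 0 ≤ R20)
    (hCT : 1 ≤ CT) (hM : 0 ≤ M)
    (t : ℝ) (ht : t ∈ Set.Icc (0:ℝ) T)
    (hK : (∫ u in (0:ℝ)..t, Real.exp (lam2 * (β₂ - 1) * (t - u))) ≤ CT^2)
    (x y : ℝ → ℝ)
    (hx : ContinuousOn x (Set.Icc 0 T)) (hy : ContinuousOn y (Set.Icc 0 T))
    (hxy : ∀ u ∈ Set.Icc (0:ℝ) T, |x u - y u| ≤ M) :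
    nuBDB lam1 lam2 β₀ β₁ β₂ α R20 t x ≤ nuBDB lam1 lam2 β₀ β₁ β₂ α R20 t y +
        lam1 * CT * Real.sqrt β₁ * (1 + Real.sqrt (β₂ * lam2)) * M := by
  unfold nuBDB
  have key : ∀ P Q D : ℝ, Real.sqrt P ≤ Real.sqrt Q + D →
      lam1 * Real.sqrt P ≤ lam1 * Real.sqrt Q + lam1 * D := by
    intro P Q D h
    rw [← mul_add]
    exact mul_le_mul_of_nonneg_left h hlam1.le
  have e : lam1 * CT * Real.sqrt β₁ * (1 + Real.sqrt (β₂ * lam2)) * M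
      = lam1 * (CT * Real.sqrt β₁ * (1 + Real.sqrt (β₂ * lam2)) * M) := by ring
  rw [e]
  apply key
  apply aux_sqrt
  · positivity
  intro s hs
  have hsub : Set.Icc 0 t ⊆ Set.Icc 0 T := Set.Icc_subset_Icc le_rfl ht.2
  have hx' := hx.mono hsub
  have hy' := hy.mono hsub
  have ik : IntervalIntegrable (fun u => Real.exp (lam2 * (β₂ - 1) * (t - u))) volume 0 t := by
    apply Continuous.intervalIntegrable
    fun_prop
  have ix : ∀ z : ℝ → ℝ, ContinuousOn z (Set.Icc 0 t) → IntervalIntegrable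
      (fun u => Real.exp (lam2 * (β₂ - 1) * (t - u)) * (β₀ + β₁ * (z u - α)^2)) volume 0 t := by
    intro z hz
    apply ContinuousOn.intervalIntegrable
    rw [Set.uIcc_of_le ht.1]
    fun_prop
  have hpt : ∀ u ∈ Set.Icc (0:ℝ) T, β₁ * (x u - α)^2 ≤
      (1 + s) * (β₁ * (y u - α)^2) + (1 + 1 / s) * (β₁ * M ^ 2) := by
    intro u hu
    have := mul_le_mul_of_nonneg_left
      (aux_sq_s18 (x u - α) (y u - α) M s hs (by simpa using hxy u hu)) hβ₁.le
    linarith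
  have hint : (∫ u in (0:ℝ)..t, Real.exp (lam2 * (β₂ - 1) * (t - u)) * (β₀ + β₁ * (x u - α)^2))
      ≤ (1 + s) * (∫ u in (0:ℝ)..t,
          Real.exp (lam2 * (β₂ - 1) * (t - u)) * (β₀ + β₁ * (y u - α)^2))
        + ((1 + 1 / s) * (β₁ * M ^ 2)) *
          ∫ u in (0:ℝ)..t, Real.exp (lam2 * (β₂ - 1) * (t - u)) := by
    rw [← intervalIntegral.integral_const_mul, ← intervalIntegral.integral_const_mul,
      ← intervalIntegral.integral_add ((ix y hy').const_mul _) (ik.const_mul _)]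
    apply intervalIntegral.integral_mono_on ht.1 (ix x hx')
      (((ix y hy').const_mul _).add (ik.const_mul _))
    intro u hu
    have h1 := hpt u (hsub hu)
    have h2 : β₀ + β₁ * (x u - α)^2 ≤ (1 + s) * (β₀ + β₁ * (y u - α)^2)
        + (1 + 1 / s) * (β₁ * M ^ 2) := by
      have := mul_nonneg hs.le hβ₀
      linarith
    have h3 := mul_le_mul_of_nonneg_left h2 (Real.exp_pos (lam2 * (β₂ - 1) * (t - u))).le
    linarith
  have hc : 0 ≤ (1 + 1 / s) * (β₁ * M ^ 2) := by positivity
  have hint2 := hint.trans (add_le_add_right (mul_le_mul_of_nonneg_left hK hc) _)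
  have hint3 := mul_le_mul_of_nonneg_left hint2 (mul_pos hβ₂ hlam2).le
  have h1 := hpt t ht
  have hR : 0 ≤ s * (β₂ * (R20 * Real.exp (lam2 * (β₂ - 1) * t))) := by positivity
  have hb := mul_nonneg hs.le hβ₀
  have hL : (1 + 1 / s) * (β₁ * M ^ 2) * (1 + β₂ * lam2 * CT ^ 2) ≤
      (1 + 1 / s) * (CT * Real.sqrt β₁ * (1 + Real.sqrt (β₂ * lam2)) * M) ^ 2 := by
    have e1 : (CT * Real.sqrt β₁ * (1 + Real.sqrt (β₂ * lam2)) * M) ^ 2 =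
        (β₁ * M ^ 2) * (CT ^ 2 * (1 + Real.sqrt (β₂ * lam2)) ^ 2) := by
      have := Real.sq_sqrt hβ₁.le
      calc _ = Real.sqrt β₁ ^ 2 * M ^ 2 * (CT ^ 2 * (1 + Real.sqrt (β₂ * lam2)) ^ 2) := by ring
        _ = _ := by rw [this]
    rw [e1, ← mul_assoc (1 + 1 / s) (β₁ * M ^ 2) (CT ^ 2 * _)]
    apply mul_le_mul_of_nonneg_left _ hc
    have e2 := Real.sq_sqrt (mul_pos hβ₂ hlam2).le
    have e3 : 1 ≤ CT ^ 2 := one_le_pow₀ hCT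
    have e4 : 0 ≤ CT ^ 2 * (2 * Real.sqrt (β₂ * lam2)) := by positivity
    calc 1 + β₂ * lam2 * CT ^ 2 ≤ CT ^ 2 * (1 + β₂ * lam2) + CT ^ 2 * (2 * Real.sqrt (β₂ * lam2)) := by
          linarith
      _ = CT ^ 2 * (1 + Real.sqrt (β₂ * lam2) ^ 2) + CT ^ 2 * (2 * Real.sqrt (β₂ * lam2)) := by
          rw [e2]
      _ = _ := by ring
  linarith

theorem nuBDB_lipschitz
    (T lam1 lam2 β₀ β₁ β₂ α R20 CT : ℝ)
    (hT : 0 < T) (hlam1 : 0 < lam1) (hlam2 : 0 < lam2)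
    (hβ₀ : 0 ≤ β₀) (hβ₁ : 0 < β₁) (hβ₂ : 0 < β₂) (hR20 : 0 ≤ R20)
    (hCT : 1 ≤ CT)
    (hCT2 : ∀ t ∈ Set.Icc (0:ℝ) T,
      (∫ u in (0:ℝ)..t, Real.exp (lam2 * (β₂ - 1) * (t - u))) ≤ CT^2) :
    ∀ t ∈ Set.Icc (0:ℝ) T, ∀ x y : ℝ → ℝ,
      ContinuousOn x (Set.Icc 0 T) → ContinuousOn y (Set.Icc 0 T) →
      |nuBDB lam1 lam2 β₀ β₁ β₂ α R20 t x - nuBDB lam1 lam2 β₀ β₁ β₂ α R20 t y| ≤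
        lam1 * CT * Real.sqrt β₁ * (1 + Real.sqrt (β₂ * lam2)) *
          ⨆ s : Set.Icc (0:ℝ) T, |x s - y s| := by
  intro t ht x y hx hy
  have hbdd : BddAbove (Set.range fun s : Set.Icc (0:ℝ) T => |x s - y s|) := by
    have := (isCompact_Icc (a := (0:ℝ)) (b := T)).bddAbove_image ((hx.sub hy).abs)
    rwa [Set.image_eq_range] at this
  have hxy : ∀ u ∈ Set.Icc (0:ℝ) T, |x u - y u| ≤ ⨆ s : Set.Icc (0:ℝ) T, |x s - y s| :=
    fun u hu => le_ciSup hbdd (⟨u, hu⟩ : Set.Icc (0:ℝ) T)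
  have hM := (abs_nonneg _).trans (hxy t ht)
  have h1 := aux_one T lam1 lam2 β₀ β₁ β₂ α R20 CT _ hlam1 hlam2 hβ₀ hβ₁ hβ₂ hR20 hCT hM t ht
    (hCT2 t ht) x y hx hy hxy
  have h2 := aux_one T lam1 lam2 β₀ β₁ β₂ α R20 CT _ hlam1 hlam2 hβ₀ hβ₁ hβ₂ hR20 hCT hM t ht
    (hCT2 t ht) y x hy hx (fun u hu => by rw [abs_sub_comm]; exact hxy u hu)
  rw [abs_le]
  constructor <;> linarith
end

section
/- Let T > 0, λ₂ > 0, β₀ ≥ 0, β₁ > 0, β₂ > 0, α ∈ ℝ, R₂₀ ≥ 0, μ ∈ ℝ, t ∈ [0,T], and let x ∈ C([0,T], ℝ). Set N = |x(t) − α| + β₂ λ₂ · ( ∫₀^t e^{μ(t−u)} (x(u) − α)² du )^{1/2} and D = β₀ + β₁ (x(t) − α)² + β₂ ( R₂₀ e^{μ t} + λ₂ ∫₀^t e^{μ(t−u)} (β₀ + β₁ (x(u) − α)²) du ). Then N ≤ ( 1/√β₁ + β₂ λ₂ / √(β₁ β₂ λ₂) ) · √D, i.e. N ≤ (1/√β₁)(1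 + √(β₂ λ₂)) √D. -/
open MeasureTheory intervalIntegral Real Set

theorem BDB_key_estimate
    (T lam2 β₀ β₁ β₂ α R20 μ t : ℝ)
    (hT : 0 < T) (hlam2 : 0 < lam2)
    (hβ₀ : 0 ≤ β₀) (hβ₁ : 0 < β₁) (hβ₂ : 0 < β₂) (hR20 : 0 ≤ R20)
    (ht : t ∈ Set.Icc (0:ℝ) T)
    (x : ℝ → ℝ) (hx : ContinuousOn x (Set.Icc 0 T))
    (N D : ℝ)
    (hN : N = |x t - α| + β₂ * lam2 *
        Real.sqrt (∫ u in (0:ℝ)..t, Real.exp (μ * (t - u)) * (x u - α)^2))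
    (hD : D = β₀ + β₁ * (x t - α)^2 +
        β₂ * (R20 * Real.exp (μ * t) +
          lam2 * ∫ u in (0:ℝ)..t, Real.exp (μ * (t - u)) * (β₀ + β₁ * (x u - α)^2))) :
    N ≤ (1 / Real.sqrt β₁) * (1 + Real.sqrt (β₂ * lam2)) * Real.sqrt D := by
  have ht0 : (0:ℝ) ≤ t := ht.1
  have hxt : ContinuousOn x (Set.uIcc 0 t) := by
    rw [Set.uIcc_of_le ht0]
    exact hx.mono (Set.Icc_subset_Icc_right ht.2)
  have hI1 : IntervalIntegrable (fun u => β₁ * (Real.exp (μ * (t - u)) * (x u - α)^2))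
      volume 0 t := by
    apply ContinuousOn.intervalIntegrable
    fun_prop
  have hI2 : IntervalIntegrable (fun u => Real.exp (μ * (t - u)) * (β₀ + β₁ * (x u - α)^2))
      volume 0 t := by
    apply ContinuousOn.intervalIntegrable
    fun_prop
  have hJ := intervalIntegral.integral_mono_on ht0 hI1 hI2 (fun u _ => by
    nlinarith [mul_nonneg (Real.exp_pos (μ * (t - u))).le hβ₀])
  rw [intervalIntegral.integral_const_mul] at hJ
  have hI0 : 0 ≤ ∫ u in (0:ℝ)..t, Real.exp (μ * (t - u)) * (x u - α)^2 :=
    intervalIntegral.integral_nonneg ht0 (fun u _ => by positivity)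
  generalize (∫ u in (0:ℝ)..t, Real.exp (μ * (t - u)) * (x u - α)^2) = I at *
  generalize (∫ u in (0:ℝ)..t, Real.exp (μ * (t - u)) * (β₀ + β₁ * (x u - α)^2)) = J at *
  have hJ0 : 0 ≤ J := le_trans (by positivity) hJ
  have h1 : Real.sqrt β₁ * |x t - α| ≤ Real.sqrt D := by
    rw [← Real.sqrt_sq_eq_abs, ← Real.sqrt_mul hβ₁.le]
    apply Real.sqrt_le_sqrt
    have : 0 ≤ β₂ * (R20 * Real.exp (μ * t) + lam2 * J) := by positivity
    linarith
  have h2 : Real.sqrt β₁ * (Real.sqrt (β₂ * lam2) * Real.sqrt I) ≤ Real.sqrt D := by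
    rw [← Real.sqrt_mul (by positivity), ← Real.sqrt_mul hβ₁.le]
    apply Real.sqrt_le_sqrt
    have h3 : 0 ≤ β₂ * (R20 * Real.exp (μ * t)) := by positivity
    have h4 : 0 ≤ β₁ * (x t - α)^2 := by positivity
    have h5 := mul_le_mul_of_nonneg_left hJ (mul_pos hβ₂ hlam2).le
    rw [hD]
    linarith
  have hs : 0 < Real.sqrt β₁ := Real.sqrt_pos.mpr hβ₁
  have hc : Real.sqrt (β₂ * lam2) * Real.sqrt (β₂ * lam2) = β₂ * lam2 :=
    Real.mul_self_sqrt (by positivity)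
  have h6 := mul_le_mul_of_nonneg_left h2 (Real.sqrt_nonneg (β₂ * lam2))
  generalize Real.sqrt (β₂ * lam2) = c at *
  rw [hN, one_div, mul_assoc _ (1 + c), inv_mul_eq_div, le_div_iff₀ hs, ← hc]
  linarith
end
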